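/- arXiv:2211.13211 — 3 statements merged into one kernel-verified Lean document; each statement's English description precedes it below -/
import Mathlib

section
/- Let X be a real random variable with mean zero and finite variance σ² > 0, and let X* have the zero bias distribution of X. Then for every x ∈ ℝ, the cumulative distribution function of X* satisfies P(X* ≤ x) = (1/σ²) E[X (X − x) · 1_{X ≤ x}]. -/
open MeasureTheory

/-- `Xs` has the zero bias distribution of `X` (mean zero, variance `σ2`):
`E[X f(X)] = σ2 E[f'(Xs)]` for every absolutely continuous `f` (formalized as a
differentiable function with derivative `f'`) for which both expectations exist. -/
def IsZeroBias {Ω : Type*} [MeasurableSpace Ω] (P : Measure Ω)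
    (X Xs : Ω → ℝ) (σ2 : ℝ) : Prop :=
  ∀ f f' : ℝ → ℝ, (∀ x, HasDerivAt f (f' x) x) →
    Integrable (fun ω => X ω * f (X ω)) P →
    Integrable (fun ω => f' (Xs ω)) P →
    ∫ ω, X ω * f (X ω) ∂P = σ2 * ∫ ω, f' (Xs ω) ∂P

open Filter Topology

/-- A sequence of primitives, based at `x`, of uniformly bounded continuous functions that converge
to the indicator of `(-∞, x]` converges to `t ↦ min (t - x) 0`. -/
theorem tendsto_intervalIntegral_of_tendsto_indicator_Iic {x : ℝ} {g : ℕ → ℝ → ℝ}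
    (hg : ∀ n, Continuous (g n)) (hg_le : ∀ n t, ‖g n t‖ ≤ 1)
    (hlim : ∀ t, Tendsto (fun n => g n t) atTop (𝓝 ((Set.Iic x).indicator (fun _ => 1) t)))
    (t : ℝ) :
    Tendsto (fun n => ∫ s in x..t, g n s) atTop (𝓝 (min (t - x) 0)) := by
  have h_eq : ∫ s in x..t, (Set.Iic x).indicator (fun _ => (1 : ℝ)) s = min (t - x) 0 := by
    rcases le_total t x with h | h
    · rw [min_eq_left (by linarith), intervalIntegral.integral_congr (g := fun _ => (1 : ℝ))]
      · simp
      · intro s hs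
        rw [Set.uIcc_of_ge h] at hs
        exact Set.indicator_of_mem (Set.mem_Iic.2 hs.2) _
    · rw [min_eq_right (by linarith), intervalIntegral.integral_of_le h]
      refine setIntegral_eq_zero_of_ae_eq_zero <| .of_forall fun s hs => ?_
      exact Set.indicator_of_notMem (by simpa using hs.1) _
  rw [← h_eq]
  refine intervalIntegral.tendsto_integral_filter_of_dominated_convergence (fun _ => 1)
    (Eventually.of_forall fun n => (hg n).aestronglyMeasurable)
    (Eventually.of_forall fun n => Eventually.of_forall fun s _ => hg_le n s)
    intervalIntegrable_const (Eventually.of_forall fun s _ => hlim s)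

/-- The distribution function of the zero bias transform:
`P(X* ≤ x) = σ2⁻¹ E[X (X - x) 1_{X ≤ x}]`. -/
theorem zeroBias_cdf {Ω : Type*} [MeasurableSpace Ω] (P : Measure Ω)
    [IsProbabilityMeasure P] (X Xs : Ω → ℝ) (hX : Measurable X) (hXs : Measurable Xs)
    (σ2 : ℝ) (hσ2 : 0 < σ2) (hint : Integrable X P)
    (hmean : ∫ ω, X ω ∂P = 0) (hvar : ∫ ω, (X ω) ^ 2 ∂P = σ2)
    (hzb : IsZeroBias P X Xs σ2) :
    ∀ x : ℝ,
      (P {ω | Xs ω ≤ x}).toReal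
        = σ2⁻¹ * ∫ ω, Set.indicator {ω' | X ω' ≤ x} (fun ω' => X ω' * (X ω' - x)) ω ∂P := by
  intro x
  have hsq : Integrable (fun ω => X ω ^ 2) P := by
    by_contra h
    rw [integral_undef h] at hvar
    exact hσ2.ne hvar
  have hbound : Integrable (fun ω => X ω ^ 2 + |x| * |X ω|) P := hsq.add (hint.abs.const_mul _)
  have hF : IsClosed (Set.Iic x) := isClosed_Iic
  let g : ℕ → ℝ → ℝ := fun n t => (hF.apprSeq n t : ℝ)
  have hg (n : ℕ) : Continuous (g n) := NNReal.continuous_coe.comp (hF.apprSeq n).continuous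
  have hg_le (n : ℕ) (t : ℝ) : ‖g n t‖ ≤ 1 := by
    simpa [g] using HasOuterApproxClosed.apprSeq_apply_le_one hF n t
  have hlim (t : ℝ) :
      Tendsto (fun n => g n t) atTop (𝓝 ((Set.Iic x).indicator (fun _ => 1) t)) := by
    have h := (NNReal.tendsto_coe.2 (tendsto_pi_nhds.1 (HasOuterApproxClosed.tendsto_apprSeq hF) t))
    convert h using 2
    by_cases ht : t ∈ Set.Iic x <;> simp [Set.indicator, ht]
  let f : ℕ → ℝ → ℝ := fun n t => ∫ s in x..t, g n s
  have hf (n : ℕ) (t : ℝ) : HasDerivAt (f n) (g n t) t :=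
    ((hg n).integral_hasStrictDerivAt x t).hasDerivAt
  have hf_cont (n : ℕ) : Continuous (f n) :=
    continuous_iff_continuousAt.2 fun t => (hf n t).continuousAt
  have hXf_meas (n : ℕ) : AEStronglyMeasurable (fun ω => X ω * f n (X ω)) P :=
    (hX.mul ((hf_cont n).measurable.comp hX)).aestronglyMeasurable
  have hXf_le (n : ℕ) (ω : Ω) : ‖X ω * f n (X ω)‖ ≤ X ω ^ 2 + |x| * |X ω| := by
    have h : ‖f n (X ω)‖ ≤ 1 * |X ω - x| :=
      intervalIntegral.norm_integral_le_of_norm_le_const fun s _ => hg_le n s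
    have h' : ‖f n (X ω)‖ ≤ |X ω| + |x| := by linarith [abs_sub (X ω) x]
    calc ‖X ω * f n (X ω)‖ = |X ω| * ‖f n (X ω)‖ := norm_mul _ _
      _ ≤ |X ω| * (|X ω| + |x|) := by gcongr
      _ = X ω ^ 2 + |x| * |X ω| := by rw [← sq_abs]; ring
  have hgXs_meas (n : ℕ) : AEStronglyMeasurable (fun ω => g n (Xs ω)) P :=
    ((hg n).measurable.comp hXs).aestronglyMeasurable
  have hident (n : ℕ) : ∫ ω, X ω * f n (X ω) ∂P = σ2 * ∫ ω, g n (Xs ω) ∂P :=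
    hzb (f n) (g n) (hf n) (hbound.mono' (hXf_meas n) (.of_forall (hXf_le n)))
      ((integrable_const (1 : ℝ)).mono' (hgXs_meas n) (.of_forall fun ω => hg_le n (Xs ω)))
  have hleft : Tendsto (fun n => ∫ ω, X ω * f n (X ω) ∂P) atTop
      (𝓝 (∫ ω, X ω * min (X ω - x) 0 ∂P)) :=
    tendsto_integral_of_dominated_convergence _ hXf_meas hbound
      (fun n => .of_forall (hXf_le n)) (.of_forall fun ω =>
        (tendsto_intervalIntegral_of_tendsto_indicator_Iic hg hg_le hlim (X ω)).const_mul _)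
  have hright : Tendsto (fun n => ∫ ω, g n (Xs ω) ∂P) atTop
      (𝓝 (∫ ω, (Set.Iic x).indicator (fun _ => (1 : ℝ)) (Xs ω) ∂P)) :=
    tendsto_integral_of_dominated_convergence _ hgXs_meas (integrable_const (1 : ℝ))
      (fun n => .of_forall fun ω => hg_le n (Xs ω)) (.of_forall fun ω => hlim (Xs ω))
  have hcdf : ∫ ω, (Set.Iic x).indicator (fun _ => (1 : ℝ)) (Xs ω) ∂P
      = (P {ω | Xs ω ≤ x}).toReal :=
    integral_indicator_one (hXs measurableSet_Iic)
  have hmin (ω : Ω) : Set.indicator {ω' | X ω' ≤ x} (fun ω' => X ω' * (X ω' - x)) ω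
      = X ω * min (X ω - x) 0 := by
    by_cases h : X ω ≤ x
    · simp [Set.indicator, h]
    · simp [Set.indicator, h, (not_le.1 h).le]
  simp_rw [hident] at hleft
  rw [integral_congr_ae (.of_forall hmin), tendsto_nhds_unique hleft (hright.const_mul σ2), hcdf,
    inv_mul_cancel_left₀ hσ2.ne']
end

section
/- Let X be a centered real random variable whose moment generating function M(λ) = E[exp(λX)] is finite for all λ ≥ 0 and differentiable on [0,∞), and suppose that M'(λ) ≤ k² λ M(λ) for all λ ≥ 0, where k > 0. Then E[exp(λX)] ≤ exp(λ²k²/2) for all λ ≥ 0, i.e. X has a sub-Gaussian right tail of constant k². -/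
open MeasureTheory

/-- A function on `[0, ∞)` satisfying the differential inequality `f'(t) ≤ c t f(t)` is bounded by
`f(0) exp(c t² / 2)`. -/
theorem le_mul_exp_sq_of_hasDerivWithinAt_le {f f' : ℝ → ℝ} {c : ℝ}
    (hf : ∀ t, 0 ≤ t → HasDerivWithinAt f (f' t) (Set.Ici 0) t)
    (hle : ∀ t, 0 ≤ t → f' t ≤ c * t * f t) {t : ℝ} (ht : 0 ≤ t) :
    f t ≤ f 0 * Real.exp (c * t ^ 2 / 2) := by
  have hexp (s : ℝ) : HasDerivAt (fun s => Real.exp (-(c * s ^ 2 / 2)))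
      (Real.exp (-(c * s ^ 2 / 2)) * -(c * s)) s := by
    refine HasDerivAt.exp (HasDerivAt.fun_neg ?_)
    refine (((hasDerivAt_pow 2 s).const_mul c).div_const 2).congr_deriv ?_
    push_cast
    ring
  have hg (s : ℝ) (hs : 0 ≤ s) := (hf s hs).mul (hexp s).hasDerivWithinAt
  have hanti := antitoneOn_of_hasDerivWithinAt_nonpos (convex_Ici 0)
    (fun s hs => (hg s hs).continuousWithinAt)
    (fun s hs => (hg s (interior_subset hs)).mono interior_subset)
    (fun s hs => by
      have := mul_nonneg (sub_nonneg.2 (hle s (interior_subset hs)))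
        (Real.exp_pos (-(c * s ^ 2 / 2))).le
      linarith)
  have h := hanti Set.self_mem_Ici ht ht
  simp only [Pi.mul_apply, Real.exp_neg] at h
  simpa [← div_eq_mul_inv, div_le_iff₀ (Real.exp_pos _)] using h

/-- If the moment generating function `M(λ) = E[exp(λ X)]` of a centered random
variable `X` is finite and differentiable on `[0, ∞)` and satisfies
`M'(λ) ≤ k² λ M(λ)` for all `λ ≥ 0`, then `X` has a sub-Gaussian right tail of
constant `k²`: `E[exp(λ X)] ≤ exp(λ² k² / 2)` for all `λ ≥ 0`. -/
theorem subGaussian_of_mgf_deriv_le {Ω : Type*} [MeasurableSpace Ω] (P : Measure Ω)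
    [IsProbabilityMeasure P] (X : Ω → ℝ) (hX : Measurable X)
    (hint : Integrable X P) (hmean : ∫ ω, X ω ∂P = 0)
    (k : ℝ) (hk : 0 < k)
    (hfin : ∀ l : ℝ, 0 ≤ l → Integrable (fun ω => Real.exp (l * X ω)) P)
    (M' : ℝ → ℝ)
    (hderiv : ∀ l : ℝ, 0 ≤ l →
      HasDerivWithinAt (fun t => ∫ ω, Real.exp (t * X ω) ∂P) (M' l) (Set.Ici 0) l)
    (hineq : ∀ l : ℝ, 0 ≤ l → M' l ≤ k ^ 2 * l * ∫ ω, Real.exp (l * X ω) ∂P) :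
    ∀ l : ℝ, 0 ≤ l → ∫ ω, Real.exp (l * X ω) ∂P ≤ Real.exp (l ^ 2 * k ^ 2 / 2) := by
  intro l hl
  have h := le_mul_exp_sq_of_hasDerivWithinAt_le hderiv hineq hl
  simpa [mul_comm (k ^ 2)] using h
end

section
/- Let X be a real random variable with mean zero and finite variance σ² > 0 and density f_X = exp(−φ) with φ differentiable, and let X* have the zero bias distribution of X, with density f_{X*}(t) = (1/σ²) E[X · 1_{X > t}]. Suppose there are x_l < 0 < x_r such that φ'(x) ≤ x/σ² for all x ≤ x_l and φ'(x) ≥ x/σ² for all x ≥ x_r. Then f_{X*}(x) ≤ f_X(x) for all x ∈ (−∞, x_l) ∪ (x_r, ∞). -/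
open MeasureTheory

/-- If `g ≥ 0` and `g' ≤ -h` on `[a, ∞)` with `h` integrable there, then `∫_a^∞ h ≤ g a`. -/
theorem setIntegral_Ioi_le_of_deriv_le_neg {g g' h : ℝ → ℝ} {a : ℝ}
    (hg : ∀ y, HasDerivAt g (g' y) y) (hg0 : ∀ y, 0 ≤ g y)
    (hh : IntegrableOn h (Set.Ioi a)) (hle : ∀ y, a ≤ y → g' y ≤ -h y) :
    ∫ t in Set.Ioi a, h t ≤ g a := by
  refine le_of_tendsto (intervalIntegral_tendsto_integral_Ioi a hh Filter.tendsto_id) ?_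
  filter_upwards [Filter.eventually_ge_atTop a] with y hy
  have key := intervalIntegral.integral_le_sub_of_hasDeriv_right_of_le (g := fun t => -g t)
    (g' := fun t => -g' t) (φ := h) hy
    (fun t _ => (hg t).neg.continuousAt.continuousWithinAt)
    (fun t _ => (hg t).neg.hasDerivWithinAt)
    ((integrableOn_Icc_iff_integrableOn_Ioc).2 (hh.mono_set Set.Ioc_subset_Ioi_self))
    (fun t ht => by have := hle t ht.1.le; linarith)
  have := hg0 y
  simp only [id]
  linarith

/-- If `g ≥ 0` and `h ≤ g'` on `(-∞, a]` with `h` integrable there, then `∫_{-∞}^a h ≤ g a`. -/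
theorem setIntegral_Iic_le_of_le_deriv {g g' h : ℝ → ℝ} {a : ℝ}
    (hg : ∀ y, HasDerivAt g (g' y) y) (hg0 : ∀ y, 0 ≤ g y)
    (hh : IntegrableOn h (Set.Iic a)) (hle : ∀ y, y ≤ a → h y ≤ g' y) :
    ∫ t in Set.Iic a, h t ≤ g a := by
  refine le_of_tendsto (intervalIntegral_tendsto_integral_Iic a hh Filter.tendsto_id) ?_
  filter_upwards [Filter.eventually_le_atBot a] with y hy
  have key := intervalIntegral.integral_le_sub_of_hasDeriv_right_of_le (g := g)
    (g' := g') (φ := h) hy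
    (fun t _ => (hg t).continuousAt.continuousWithinAt)
    (fun t _ => (hg t).hasDerivWithinAt)
    ((integrableOn_Icc_iff_integrableOn_Ioc).2 (hh.mono_set Set.Ioc_subset_Iic_self))
    (fun t ht => hle t ht.2.le)
  have := hg0 y
  simp only [id]
  linarith

/-- If `X` has density `exp(-φ)` with `φ'(x) ≤ x/σ²` for `x ≤ x_l < 0` and
`φ'(x) ≥ x/σ²` for `x ≥ x_r > 0`, then the density `f_{X*}(t) = σ2⁻¹ E[X 1_{X>t}]`
of the zero bias transform satisfies `f_{X*}(x) ≤ f_X(x)` on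
`(-∞, x_l) ∪ (x_r, ∞)`. -/
theorem zeroBias_density_le_of_tails {Ω : Type*} [MeasurableSpace Ω] (P : Measure Ω)
    [IsProbabilityMeasure P] (X Xs : Ω → ℝ) (hX : Measurable X) (hXs : Measurable Xs)
    (σ2 : ℝ) (hσ2 : 0 < σ2) (hint : Integrable X P)
    (hmean : ∫ ω, X ω ∂P = 0) (hvar : ∫ ω, (X ω) ^ 2 ∂P = σ2)
    (hzb : IsZeroBias P X Xs σ2)
    (φ φ' : ℝ → ℝ) (hφ : ∀ x, HasDerivAt φ (φ' x) x)
    (hden : Measure.map X P = volume.withDensity (fun x => ENNReal.ofReal (Real.exp (-φ x))))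
    (fXs : ℝ → ℝ)
    (hfXs : ∀ t : ℝ, fXs t = σ2⁻¹ * ∫ ω, Set.indicator {ω' | t < X ω'} X ω ∂P)
    (hdenXs : Measure.map Xs P = volume.withDensity (fun x => ENNReal.ofReal (fXs x)))
    (xl xr : ℝ) (hxl : xl < 0) (hxr : 0 < xr)
    (hleft : ∀ x : ℝ, x ≤ xl → φ' x ≤ x / σ2)
    (hright : ∀ x : ℝ, xr ≤ x → x / σ2 ≤ φ' x) :
    ∀ x : ℝ, x ∈ Set.Iio xl ∪ Set.Ioi xr → fXs x ≤ Real.exp (-φ x) := by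
  have hφc : Continuous φ := continuous_iff_continuousAt.2 fun x => (hφ x).continuousAt
  have hmeas : Measurable fun x => ENNReal.ofReal (Real.exp (-φ x)) :=
    (Real.continuous_exp.comp hφc.neg).measurable.ennreal_ofReal
  have htoReal : (fun x : ℝ => (ENNReal.ofReal (Real.exp (-φ x))).toReal • x) =
      fun x => Real.exp (-φ x) * x := by
    ext x
    rw [ENNReal.toReal_ofReal (Real.exp_pos _).le, smul_eq_mul]
  have hintg : Integrable (fun x : ℝ => Real.exp (-φ x) * x) := by
    rw [← htoReal, ← integrable_withDensity_iff_integrable_smul' hmeas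
      (Filter.Eventually.of_forall fun _ => ENNReal.ofReal_lt_top), ← hden]
    exact (integrable_map_measure measurable_id.aestronglyMeasurable hX.aemeasurable).2 hint
  have hset (s : Set ℝ) (hs : MeasurableSet s) :
      ∫ ω in X ⁻¹' s, X ω ∂P = ∫ x in s, Real.exp (-φ x) * x := by
    rw [← htoReal, ← setIntegral_withDensity_eq_setIntegral_toReal_smul hmeas
      (Filter.Eventually.of_forall fun _ => ENNReal.ofReal_lt_top) _ hs, ← hden]
    exact (setIntegral_map hs measurable_id.aestronglyMeasurable hX.aemeasurable).symm
  have hfIoi (t : ℝ) : fXs t = σ2⁻¹ * ∫ x in Set.Ioi t, Real.exp (-φ x) * x := by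
    rw [hfXs, ← hset _ measurableSet_Ioi]
    congr 1
    exact integral_indicator (hX measurableSet_Ioi)
  have hmean' : ∫ x, Real.exp (-φ x) * x = 0 := by
    simpa [hmean] using (hset Set.univ MeasurableSet.univ).symm
  have hfIic (t : ℝ) : fXs t = -σ2⁻¹ * ∫ x in Set.Iic t, Real.exp (-φ x) * x := by
    have h := integral_add_compl (measurableSet_Iic (a := t)) hintg
    rw [hmean', Set.compl_Iic] at h
    rw [hfIoi, eq_neg_of_add_eq_zero_right h]
    ring
  have hderiv (y : ℝ) : HasDerivAt (fun x => Real.exp (-φ x)) (Real.exp (-φ y) * -φ' y) y :=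
    (hφ y).neg.exp
  rintro x (hx | hx)
  · rw [hfIic, ← integral_const_mul]
    refine setIntegral_Iic_le_of_le_deriv hderiv (fun _ => (Real.exp_pos _).le)
      (hintg.const_mul _).integrableOn fun y hy => ?_
    have h := mul_le_mul_of_nonneg_left (hleft y (hy.trans (Set.mem_Iio.1 hx).le))
      (Real.exp_pos (-φ y)).le
    rw [div_eq_mul_inv] at h
    linarith
  · rw [hfIoi, ← integral_const_mul]
    refine setIntegral_Ioi_le_of_deriv_le_neg hderiv (fun _ => (Real.exp_pos _).le)
      (hintg.const_mul _).integrableOn fun y hy => ?_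
    have h := mul_le_mul_of_nonneg_left (hright y ((Set.mem_Ioi.1 hx).le.trans hy))
      (Real.exp_pos (-φ y)).le
    rw [div_eq_mul_inv] at h
    linarith
end
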